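/- arXiv:2502.05681 — 3 statements merged into one kernel-verified Lean document; each statement's English description precedes it below -/
import Mathlib

section
/- Let p be a prime and k ≥ 1 a natural number, and set n = p·k. Let V = ∏_{i < j, i,j ∈ Fin n} (X_j − X_i) be the Vandermonde polynomial in the multivariate polynomial ring (ZMod p)[X_0, …, X_{n−1}]. Then the polynomial obtained from V by applying, once for each index i with i < (p−1)·k, the formal partial derivative ∂/∂X_i, is nonzero. -/
open MvPolynomial

lemma aux_fold {σ R : Type*} [Field R] (f : MvPolynomial σ R) (e : σ →₀ ℕ)
    (hf : coeff e f ≠ 0) (l : List σ) (hl : l.Nodup) (he : ∀ i ∈ l, ((e i : ℕ) : R) ≠ 0) :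
    ∃ m : σ →₀ ℕ, coeff m (l.foldr (fun i q => pderiv i q) f) ≠ 0 ∧ ∀ j, j ∉ l → m j = e j := by
  classical
  induction l with
  | nil => exact ⟨e, hf, fun _ _ => rfl⟩
  | cons i l ih =>
    rw [List.nodup_cons] at hl
    obtain ⟨m, hm, hj⟩ := ih hl.2 (fun j hj => he j (List.mem_cons_of_mem _ hj))
    have hi : ((m i : ℕ) : R) ≠ 0 := by
      rw [hj i hl.1]; exact he i List.mem_cons_self
    have hi0 : m i ≠ 0 := by rintro h; simp [h] at hi
    have hle : Finsupp.single i 1 ≤ m := by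
      rw [Finsupp.single_le_iff]; omega
    refine ⟨m - Finsupp.single i 1, ?_, ?_⟩
    · rw [List.foldr_cons, coeff_pderiv, tsub_add_cancel_of_le hle]
      refine mul_ne_zero hm ?_
      have : (m - Finsupp.single i 1 : σ →₀ ℕ) i + 1 = m i := by
        simp; omega
      exact_mod_cast this ▸ hi
    · intro j hjl
      rw [List.mem_cons, not_or] at hjl
      rw [Finsupp.tsub_apply, Finsupp.single_eq_of_ne (by tauto), hj j hjl.2, Nat.sub_zero]

lemma aux_vand {n : ℕ} {R : Type*} [Field R] (s : Equiv.Perm (Fin n)) :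
    coeff (Finsupp.equivFunOnFinite.symm (fun i => ((s i : Fin n) : ℕ)))
      (∏ j : Fin n, ∏ i ∈ Finset.Iio j, (X j - X i : MvPolynomial (Fin n) R)) ≠ 0 := by
  classical
  have h1 : (∏ j : Fin n, ∏ i ∈ Finset.Iio j, (X j - X i : MvPolynomial (Fin n) R))
      = (Matrix.vandermonde (fun i => (X i : MvPolynomial (Fin n) R))).det := by
    rw [Matrix.det_vandermonde]
    apply Finset.prod_comm'
    simp
  have h2 : ∀ t : Equiv.Perm (Fin n),
      ∏ i, Matrix.vandermonde (fun i => (X i : MvPolynomial (Fin n) R)) (t i) i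
      = monomial (Finsupp.equivFunOnFinite.symm (fun i => ((t.symm i : Fin n) : ℕ))) 1 := by
    intro t
    rw [← Equiv.prod_comp t.symm, monomial_eq, Finsupp.prod_fintype _ _ (by simp)]
    simp [Matrix.vandermonde_apply]
  rw [h1, Matrix.det_apply, coeff_sum, Finset.sum_eq_single s.symm]
  · rw [h2]
    rcases Int.units_eq_one_or (Equiv.Perm.sign s.symm) with h | h <;> rw [h] <;> simp
  · intro t _ ht
    rw [h2]
    have : (Finsupp.equivFunOnFinite.symm (fun i => ((t.symm i : Fin n) : ℕ)))
        ≠ (Finsupp.equivFunOnFinite.symm (fun i => ((s i : Fin n) : ℕ))) := by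
      intro h
      apply ht
      have h' := Finsupp.equivFunOnFinite.symm.injective h
      have : t.symm = s := Equiv.ext fun i => Fin.ext (congrFun h' i)
      rw [← this]; rfl
    rcases Int.units_eq_one_or (Equiv.Perm.sign t) with h | h <;> rw [h] <;>
      simp [coeff_monomial, this]
  · simp

/-- Let `p` be a prime, `k ≥ 1`, and `n = p * k`.  Applying to the Vandermonde polynomial
`∏_{i < j} (X j - X i)` over `ZMod p` the formal partial derivative `∂/∂X i` once for every
index `i < (p - 1) * k` yields a nonzero polynomial. -/
theorem pderiv_fold_vandermonde_ne_zero (p k : ℕ) (hp : p.Prime) (hk : 1 ≤ k) :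
    ((Finset.univ.filter (fun i : Fin (p * k) => (i : ℕ) < (p - 1) * k)).toList.foldr
        (fun i q => pderiv i q)
        (∏ j : Fin (p * k), ∏ i ∈ Finset.Iio j,
          (X j - X i : MvPolynomial (Fin (p * k)) (ZMod p)))) ≠ 0 := by
  haveI : Fact p.Prime := ⟨hp⟩
  let s : Equiv.Perm (Fin (p * k)) :=
    ((finProdFinEquiv.symm.trans ((Equiv.prodComm (Fin p) (Fin k)).trans
      (Equiv.prodCongr (Equiv.refl _) Fin.revPerm))).trans finProdFinEquiv).trans
      (finCongr (mul_comm k p))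
  have hs : ∀ i, ((s i : Fin (p * k)) : ℕ) = (p - ((i : ℕ) / k + 1)) + p * ((i : ℕ) % k) := by
    intro i
    simp [s, finProdFinEquiv, Fin.val_rev]
  obtain ⟨m, hm, -⟩ := aux_fold _ _ (aux_vand (R := ZMod p) s)
    (Finset.univ.filter (fun i : Fin (p * k) => (i : ℕ) < (p - 1) * k)).toList
    (Finset.nodup_toList _) (by
      intro i hi
      simp only [Finset.mem_toList, Finset.mem_filter, Finset.mem_univ, true_and] at hi
      have hd : (i : ℕ) / k < p - 1 := (Nat.div_lt_iff_lt_mul hk).2 hi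
      rw [Finsupp.equivFunOnFinite_symm_apply_apply, hs, Ne, ZMod.natCast_eq_zero_iff]
      rw [Nat.dvd_add_left (dvd_mul_right _ _)]
      generalize (i : ℕ) / k = d at hd ⊢
      intro h
      have := Nat.le_of_dvd (by omega) h
      omega)
  intro h
  rw [h] at hm
  simp at hm
end

section
/- Let p be a prime and n a natural number. Let V = ∏_{i < j, i,j ∈ Fin n} (X_j − X_i) be the Vandermonde polynomial in (ZMod p)[X_0, …, X_{n−1}], and let S ⊆ Fin n be a subset whose cardinality is at most the number of m ∈ {0, 1, …, n−1} not divisible by p. Then the polynomial obtained from V by applying, once for each i ∈ S, the formal partial derivative ∂/∂X_i, is nonzero. -/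
open MvPolynomial

lemma coeff_foldr_pderiv_aux {n : ℕ} {R : Type*} [CommSemiring R] (q : MvPolynomial (Fin n) R)
    (L : List (Fin n)) (hL : L.Nodup) (m : Fin n →₀ ℕ) :
    coeff m (L.foldr (fun i q => pderiv i q) q) =
      coeff (m + (L.map fun i => Finsupp.single i 1).sum) q *
        (L.map fun i => ((m i : R) + 1)).prod := by
  induction L generalizing m with
  | nil => simp
  | cons a l ih =>
    rw [List.nodup_cons] at hL
    rw [List.foldr_cons, coeff_pderiv, ih hL.2]
    have : (l.map fun i => (((m + Finsupp.single a 1 : Fin n →₀ ℕ) i : ℕ) : R) + 1)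
        = l.map fun i => ((m i : R) + 1) := by
      apply List.map_congr_left
      intro i hi
      have : a ≠ i := fun h => hL.1 (h ▸ hi)
      simp [Finsupp.single_apply, this]
    rw [this]
    simp only [List.map_cons, List.sum_cons, List.prod_cons, add_assoc]
    ring

lemma coeff_vandermonde_aux {n : ℕ} {R : Type*} [CommRing R] (π : Equiv.Perm (Fin n)) :
    coeff (Finsupp.equivFunOnFinite.symm fun i => (π i : ℕ))
      (∏ j : Fin n, ∏ i ∈ Finset.Iio j, (X j - X i : MvPolynomial (Fin n) R)) =
      ((Equiv.Perm.sign π : ℤ) : R) := by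
  have h1 : (∏ j : Fin n, ∏ i ∈ Finset.Iio j, (X j - X i : MvPolynomial (Fin n) R))
      = (Matrix.vandermonde (fun i => (X i : MvPolynomial (Fin n) R))).det := by
    rw [Matrix.det_vandermonde]
    apply Finset.prod_comm'
    simp
  have h2 : ∀ σ : Equiv.Perm (Fin n), ∏ i, (X i : MvPolynomial (Fin n) R) ^ (σ i : ℕ) =
      monomial (Finsupp.equivFunOnFinite.symm fun i => (σ i : ℕ)) 1 := by
    intro σ
    rw [monomial_eq, Finsupp.prod_fintype _ _ (by simp)]
    simp
  rw [h1, ← Matrix.det_transpose, Matrix.det_apply', coeff_sum]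
  simp only [Matrix.transpose_apply, Matrix.vandermonde_apply, h2]
  rw [Finset.sum_eq_single π]
  · rw [← map_intCast (C : R →+* MvPolynomial (Fin n) R), coeff_C_mul]
    simp
  · intro σ _ hσ
    rw [← map_intCast (C : R →+* MvPolynomial (Fin n) R), coeff_C_mul, coeff_monomial, if_neg,
      mul_zero]
    intro h
    apply hσ
    ext i
    simpa using DFunLike.congr_fun h i
  · simp

lemma exists_perm_aux (p n : ℕ) (S : Finset (Fin n))
    (hS : S.card ≤ ((Finset.range n).filter (fun m => ¬ p ∣ m)).card) :
    ∃ π : Equiv.Perm (Fin n), ∀ i ∈ S, ¬ p ∣ (π i : ℕ) := by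
  have h : ((Finset.range n).filter (fun m => ¬ p ∣ m)).card =
      ((Finset.univ : Finset (Fin n)).filter (fun m : Fin n => ¬ p ∣ (m : ℕ))).card := by
    symm
    apply Finset.card_bij (fun (a : Fin n) _ => (a : ℕ))
    · simp
    · intro a _ b _ h
      exact Fin.ext h
    · intro b hb
      simp only [Finset.mem_filter, Finset.mem_range] at hb
      exact ⟨⟨b, hb.1⟩, by simpa using hb.2, rfl⟩
  rw [h] at hS
  obtain ⟨T, hT, hc⟩ := Finset.exists_subset_card_eq hS
  let e : {x // x ∈ S} ≃ {x // x ∈ T} := Finset.equivOfCardEq hc.symm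
  refine ⟨e.extendSubtype, fun i hi => ?_⟩
  have := hT (e.extendSubtype_mem i hi)
  simpa using this

/-- Let `p` be a prime and `S ⊆ Fin n` a set whose cardinality is at most the number of
`m ∈ {0, …, n-1}` not divisible by `p`.  Applying to the Vandermonde polynomial
`∏_{i < j} (X j - X i)` over `ZMod p` the formal partial derivative `∂/∂X i` once for each
`i ∈ S` yields a nonzero polynomial. -/
theorem pderiv_fold_vandermonde_ne_zero_of_card_le (p n : ℕ) (hp : p.Prime)
    (S : Finset (Fin n))
    (hS : S.card ≤ ((Finset.range n).filter (fun m => ¬ p ∣ m)).card) :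
    (S.toList.foldr (fun i q => pderiv i q)
        (∏ j : Fin n, ∏ i ∈ Finset.Iio j,
          (X j - X i : MvPolynomial (Fin n) (ZMod p)))) ≠ 0 := by
  haveI : Fact p.Prime := ⟨hp⟩
  obtain ⟨π, hπ⟩ := exists_perm_aux p n S hS
  have hpos : ∀ i ∈ S, 1 ≤ (π i : ℕ) := fun i hi =>
    Nat.one_le_iff_ne_zero.2 fun h => hπ i hi (h ▸ dvd_zero p)
  let m : Fin n →₀ ℕ := Finsupp.equivFunOnFinite.symm fun i => (π i : ℕ) - if i ∈ S then 1 else 0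
  intro h0
  have h := coeff_foldr_pderiv_aux (∏ j : Fin n, ∏ i ∈ Finset.Iio j,
          (X j - X i : MvPolynomial (Fin n) (ZMod p))) S.toList S.nodup_toList m
  have hm : m + (S.toList.map fun i => Finsupp.single i 1).sum =
      Finsupp.equivFunOnFinite.symm fun i => (π i : ℕ) := by
    rw [Finset.sum_map_toList]
    ext i
    simp only [Finsupp.add_apply, Finsupp.finsetSum_apply, Finsupp.single_apply,
      Finset.sum_ite_eq', m, Finsupp.equivFunOnFinite_symm_apply_apply]
    split_ifs with hi
    · exact Nat.sub_add_cancel (hpos i hi)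
    · simp
  rw [h0, hm, coeff_vandermonde_aux, coeff_zero, Finset.prod_map_toList] at h
  rcases mul_eq_zero.1 h.symm with h | h
  · rcases Int.units_eq_one_or (Equiv.Perm.sign π) with h' | h' <;> simp [h'] at h
  · obtain ⟨i, hi, h⟩ := Finset.prod_eq_zero_iff.1 h
    apply hπ i hi
    rw [← ZMod.natCast_eq_zero_iff, ← h, ← Nat.cast_add_one]
    congr 1
    have := hpos i hi
    simp only [m, Finsupp.equivFunOnFinite_symm_apply_apply, if_pos hi]
    omega
end

section
/- Let p be a prime, let A be a commutative ring graded by the natural numbers (with graded pieces 𝒜_j, so that x ∈ 𝒜_j and y ∈ 𝒜_{j'} imply x·y ∈ 𝒜_{j+j'}), and let d be a natural number. Assume the p-anisotropy property: for every j and every x ∈ 𝒜_j with p·j ≤ d, if x ≠ 0 then x^p ≠ 0. Then for every k, every nonzero u ∈ 𝒜_k, and all positive integers m, n with m ≤ p·n and p·n·k ≤ d, one has u^m ≠ 0. -/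
/-- Let `p` be a prime and `A` a commutative ring graded by `ℕ` (pieces `𝒜 j`, with
`𝒜 j * 𝒜 j' ⊆ 𝒜 (j + j')`).  If for every `j` and every `x ∈ 𝒜 j` with `p * j ≤ d`,
`x ≠ 0` implies `x ^ p ≠ 0`, then for every `k`, every nonzero `u ∈ 𝒜 k`, and all
positive integers `m`, `n` with `m ≤ p * n` and `p * n * k ≤ d`, we have `u ^ m ≠ 0`. -/
theorem pow_ne_zero_of_p_anisotropy (p : ℕ) (hp : p.Prime) (A : Type*) [CommRing A]
    (𝒜 : ℕ → AddSubmonoid A) (d : ℕ)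
    (hmul : ∀ {j j' : ℕ} {x y : A}, x ∈ 𝒜 j → y ∈ 𝒜 j' → x * y ∈ 𝒜 (j + j'))
    (haniso : ∀ (j : ℕ) (x : A), x ∈ 𝒜 j → p * j ≤ d → x ≠ 0 → x ^ p ≠ 0) :
    ∀ (k : ℕ) (u : A), u ∈ 𝒜 k → u ≠ 0 →
      ∀ m n : ℕ, 0 < m → 0 < n → m ≤ p * n → p * n * k ≤ d → u ^ m ≠ 0 := by
  intro k u hu hu0
  have hmem : ∀ n : ℕ, u ^ (n + 1) ∈ 𝒜 ((n + 1) * k) := by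
    intro n
    induction n with
    | zero => simpa using hu
    | succ n ih =>
      have h := hmul ih hu
      rw [← pow_succ] at h
      have e : (n + 1) * k + k = (n + 1 + 1) * k := by ring
      rwa [e] at h
  have hdiv : ∀ a b : ℕ, a ≤ b → u ^ b ≠ 0 → u ^ a ≠ 0 := by
    intro a b hab hb ha
    exact hb (pow_eq_zero_of_le hab ha)
  have hpow : ∀ n : ℕ, p * (n + 1) * k ≤ d → u ^ (n + 1) ≠ 0 → u ^ (p * (n + 1)) ≠ 0 := by
    intro n hn h0
    have h := haniso _ _ (hmem n) (by rwa [← mul_assoc]) h0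
    rwa [← pow_mul, mul_comm] at h
  have hmain : ∀ n : ℕ, p * (n + 1) * k ≤ d → u ^ (n + 1) ≠ 0 := by
    intro n
    induction n with
    | zero => intro _; simpa using hu0
    | succ n ih =>
      intro hn
      have hn' : p * (n + 1) * k ≤ d := le_trans (by gcongr; omega) hn
      refine hdiv _ (p * (n + 1)) ?_ (hpow n hn' (ih hn'))
      have := hp.two_le
      nlinarith
  intro m n _ hn hm hd
  obtain ⟨n, rfl⟩ := Nat.exists_eq_succ_of_ne_zero hn.ne'
  exact hdiv m _ hm (hpow n hd (hmain n hd))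
end
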